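/- arXiv:2102.13182 — 3 statements merged into one kernel-verified Lean document; each statement's English description precedes it below -/
import Mathlib

section
/- Partition the d coordinates of [0,1]^d as u = (w, v_1, …, v_q), where w is a single coordinate and v_1, …, v_q are pairwise disjoint blocks of coordinates not containing w. For each i, let η_i be a bounded continuous vector-valued function of (w, v_i) with first coordinate the constant 1 and linearly independent coordinates, and let β_i be a constraint vector such that the set of copula distributions on the (w, v_i)-cube satisfying E[η_i] = β_i is nonempty and contains an element of finite differential entropy. Let Q_i, with density q_i, be the unique maximum-entropy copula distribution on the (w, v_i)-cube under E[η_i] = β_i. Then g(u) := ∏_{i=1}^q q_i(w, v_i) is a copula density on [0,1]^d, the corresponding distribution satisfies E[η_i] = β_i for every i, it is the unique maximum-entropy copula distribution on [0,1]^d under the combined constraints E[η_i] = β_i for i = 1, …, q, and its differential entropy equals Σ_{i=1}^q h(Q_i). -/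
open MeasureTheory Real Set Filter

noncomputable section
open scoped Classical

/-- The unit cube `[0,1]^ι`. -/
def CubeI (ι : Type*) : Set (ι → ℝ) := Set.univ.pi fun _ => Set.Icc (0:ℝ) 1

/-- The uniform distribution on `[0,1]`. -/
def unif01 : Measure ℝ := volume.restrict (Set.Icc (0:ℝ) 1)

/-- A copula distribution on `[0,1]^ι`. -/
structure IsCopulaI {ι : Type*} [Fintype ι] (P : Measure (ι → ℝ)) : Prop where
  prob : IsProbabilityMeasure P
  ac : P ≪ volume
  mass : P (CubeI ι) = 1
  marg : ∀ i : ι, P.map (fun u => u i) = unif01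

/-- Lebesgue density of a measure. -/
def dens {α : Type*} [MeasureSpace α] (P : Measure α) : α → ℝ :=
  fun x => (P.rnDeriv volume x).toReal

/-- Differential entropy `-∫ p log p` (w.r.t. Lebesgue measure). -/
def diffEnt {α : Type*} [MeasureSpace α] (P : Measure α) : ℝ :=
  - ∫ x, dens P x * Real.log (dens P x)

/-- The differential entropy of `P` exists and is finite. -/
def FiniteEnt {α : Type*} [MeasureSpace α] (P : Measure α) : Prop :=
  Integrable (fun x => dens P x * Real.log (dens P x))

/-- Index type for `[0,1]^d` with coordinates partitioned as `(w, v_1, …, v_q)`: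
a distinguished coordinate `w` plus pairwise disjoint blocks `v_i` of sizes `n i`. -/
abbrev FullIdx (Q : ℕ) (n : Fin Q → ℕ) : Type := Unit ⊕ ((i : Fin Q) × Fin (n i))

/-- Projection of a full vector onto the coordinates `(w, v_i)` of the `i`-th block. -/
def blockProj {Q : ℕ} (n : Fin Q → ℕ) (i : Fin Q) (u : FullIdx Q n → ℝ) :
    (Unit ⊕ Fin (n i)) → ℝ :=
  fun j => match j with
  | Sum.inl _ => u (Sum.inl ())
  | Sum.inr k => u (Sum.inr ⟨i, k⟩)

open scoped ENNReal

instance isProbabilityMeasure_unif01 : IsProbabilityMeasure unif01 := ⟨by simp [unif01]⟩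

/-- The uniform distribution on the unit cube. -/
def cubeMeasure (ι : Type*) [Fintype ι] : Measure (ι → ℝ) := volume.restrict (CubeI ι)

lemma cubeMeasure_eq_pi (ι : Type*) [Fintype ι] :
    cubeMeasure ι = Measure.pi fun _ : ι => unif01 := by
  rw [cubeMeasure, CubeI, volume_pi, Measure.restrict_pi_pi]; rfl

instance (ι : Type*) [Fintype ι] : IsProbabilityMeasure (cubeMeasure ι) := by
  rw [cubeMeasure_eq_pi]; infer_instance

lemma measurableSet_CubeI (ι : Type*) [Fintype ι] : MeasurableSet (CubeI ι) :=
  MeasurableSet.univ_pi fun _ => measurableSet_Icc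

/-- The point of a block with distinguished coordinate `w` and remaining coordinates `v`. -/
def blockPoint {m : ℕ} (x : ℝ × (Fin m → ℝ)) : (Unit ⊕ Fin m) → ℝ :=
  Sum.elim (fun _ => x.1) x.2

lemma measurable_blockPoint {m : ℕ} : Measurable (blockPoint (m := m)) := by
  refine measurable_pi_lambda _ fun j => ?_
  rcases j with _ | k
  · exact measurable_fst
  · exact (measurable_pi_apply k).comp measurable_snd

/-- The point of the full cube assembled from `w` and the blocks `v i`. -/
def fullPoint {Q : ℕ} (n : Fin Q → ℕ) (x : ℝ × ((i : Fin Q) → Fin (n i) → ℝ)) :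
    FullIdx Q n → ℝ :=
  Sum.elim (fun _ => x.1) fun p => x.2 p.1 p.2

lemma blockProj_fullPoint {Q : ℕ} (n : Fin Q → ℕ) (i : Fin Q)
    (x : ℝ × ((i : Fin Q) → Fin (n i) → ℝ)) :
    blockProj n i (fullPoint n x) = blockPoint (x.1, x.2 i) := by
  funext j; rcases j with _ | k <;> rfl

lemma measurable_blockProj {Q : ℕ} (n : Fin Q → ℕ) (i : Fin Q) : Measurable (blockProj n i) := by
  refine measurable_pi_lambda _ fun j => ?_
  rcases j with _ | k
  · exact measurable_pi_apply _
  · exact measurable_pi_apply _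

lemma measurePreserving_blockPoint (m : ℕ) :
    MeasurePreserving (blockPoint (m := m)) (unif01.prod (Measure.pi fun _ => unif01))
      (cubeMeasure (Unit ⊕ Fin m)) := by
  refine ⟨measurable_blockPoint, ?_⟩
  rw [cubeMeasure_eq_pi]
  refine (Measure.pi_eq fun s hs => ?_).symm
  rw [Measure.map_apply measurable_blockPoint (.univ_pi hs)]
  have : blockPoint ⁻¹' (univ.pi s) =
      s (Sum.inl ()) ×ˢ (univ.pi fun k : Fin m => s (Sum.inr k)) := by
    ext x
    simp only [Set.mem_preimage, Set.mem_univ_pi, Set.mem_prod, Sum.forall, blockPoint,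
      Sum.elim_inl, Sum.elim_inr, Unique.forall_iff]
  rw [this, Measure.prod_prod, Measure.pi_pi, Fintype.prod_sum_type]
  simp

lemma measurePreserving_fullPoint {Q : ℕ} (n : Fin Q → ℕ) :
    MeasurePreserving (fullPoint n)
      (unif01.prod (Measure.pi fun i => Measure.pi fun _ : Fin (n i) => unif01))
      (cubeMeasure (FullIdx Q n)) := by
  have hm : Measurable (fullPoint n) := by
    refine measurable_pi_lambda _ fun j => ?_
    rcases j with _ | ⟨i, k⟩
    · exact measurable_fst
    · exact (measurable_pi_apply k).comp ((measurable_pi_apply i).comp measurable_snd)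
  refine ⟨hm, ?_⟩
  rw [cubeMeasure_eq_pi]
  refine (Measure.pi_eq fun s hs => ?_).symm
  rw [Measure.map_apply hm (.univ_pi hs)]
  have : fullPoint n ⁻¹' (univ.pi s) =
      s (Sum.inl ()) ×ˢ
        (univ.pi fun i : Fin Q => univ.pi fun k : Fin (n i) => s (Sum.inr ⟨i, k⟩)) := by
    ext x
    simp only [Set.mem_preimage, Set.mem_univ_pi, Set.mem_prod, Sum.forall, fullPoint,
      Sum.elim_inl, Sum.elim_inr, Unique.forall_iff, Sigma.forall]
  rw [this, Measure.prod_prod, Measure.pi_pi, Fintype.prod_sum_type, Fintype.prod_sigma]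
  simp [Measure.pi_pi]

lemma lintegral_pi_prod {ι : Type*} [Fintype ι] {α : ι → Type*} [∀ i, MeasurableSpace (α i)]
    (μ : ∀ i, Measure (α i)) [∀ i, IsProbabilityMeasure (μ i)] {F : ∀ i, α i → ℝ≥0∞}
    (hF : ∀ i, Measurable (F i)) :
    ∫⁻ v, ∏ i, F i (v i) ∂Measure.pi μ = ∏ i, ∫⁻ x, F i x ∂μ i := by
  have hind : ProbabilityTheory.iIndepFun (fun i (v : ∀ i, α i) => F i (v i)) (Measure.pi μ) :=
    ProbabilityTheory.iIndepFun_pi fun i => (hF i).aemeasurable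
  have := ProbabilityTheory.lintegral_prod_eq_prod_lintegral_of_indepFun Finset.univ _ hind
    fun i => (hF i).comp (measurable_pi_apply i)
  rw [this]
  refine Finset.prod_congr rfl fun i _ => ?_
  exact (measurePreserving_eval μ i).lintegral_comp (hF i)

lemma lintegral_block {m : ℕ} {F : ((Unit ⊕ Fin m) → ℝ) → ℝ≥0∞} (hF : Measurable F) :
    ∫⁻ x, F x ∂cubeMeasure (Unit ⊕ Fin m) =
      ∫⁻ w, ∫⁻ v, F (blockPoint (w, v)) ∂(Measure.pi fun _ => unif01) ∂unif01 := by
  rw [← (measurePreserving_blockPoint m).lintegral_comp hF]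
  exact lintegral_prod _ (hF.comp measurable_blockPoint).aemeasurable

/-- Conditionally on `w`, the blocks of a uniform point of the full cube are independent. -/
lemma lintegral_full {Q : ℕ} (n : Fin Q → ℕ) {f : ℝ → ℝ≥0∞} (hf : Measurable f)
    {F : (i : Fin Q) → ((Unit ⊕ Fin (n i)) → ℝ) → ℝ≥0∞} (hF : ∀ i, Measurable (F i)) :
    ∫⁻ u, f (u (Sum.inl ())) * ∏ i, F i (blockProj n i u) ∂cubeMeasure (FullIdx Q n) =
      ∫⁻ w, f w * ∏ i, ∫⁻ v, F i (blockPoint (w, v)) ∂(Measure.pi fun _ => unif01) ∂unif01 := by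
  have hG : Measurable fun u : FullIdx Q n → ℝ =>
      f (u (Sum.inl ())) * ∏ i, F i (blockProj n i u) :=
    (hf.comp (measurable_pi_apply _)).mul
      (Finset.measurable_prod _ fun i _ => (hF i).comp (measurable_blockProj n i))
  rw [← (measurePreserving_fullPoint n).lintegral_comp hG]
  refine (lintegral_prod _
    (hG.comp (measurePreserving_fullPoint n).measurable).aemeasurable).trans ?_
  refine lintegral_congr fun w => ?_
  have hFw : ∀ i, Measurable fun v => F i (blockPoint (w, v)) := fun i =>
    (hF i).comp (measurable_blockPoint.comp measurable_prodMk_left)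
  simp only [Function.comp_apply, blockProj_fullPoint]
  rw [← lintegral_pi_prod _ hFw]
  have hprod : Measurable fun v : (i : Fin Q) → Fin (n i) → ℝ =>
      ∏ i, F i (blockPoint (w, v i)) :=
    Finset.measurable_prod _ fun i _ => (hFw i).comp (measurable_pi_apply i)
  rw [← lintegral_const_mul _ hprod]
  rfl

/-- A density on a block cube whose `w`-marginal is uniform integrates to `1` over almost every
fibre. -/
lemma ae_lintegral_fibre_eq_one {m : ℕ} {F : ((Unit ⊕ Fin m) → ℝ) → ℝ≥0∞} (hF : Measurable F)
    (h : ((cubeMeasure (Unit ⊕ Fin m)).withDensity F).map (fun u => u (Sum.inl ())) = unif01) :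
    ∀ᵐ w ∂unif01, ∫⁻ v, F (blockPoint (w, v)) ∂(Measure.pi fun _ => unif01) = 1 := by
  have hm : Measurable fun w => ∫⁻ v, F (blockPoint (w, v)) ∂(Measure.pi fun _ : Fin m => unif01) :=
    (hF.comp measurable_blockPoint).lintegral_prod_right'
  have hw : Measurable fun u : Unit ⊕ Fin m → ℝ => u (Sum.inl ()) := measurable_pi_apply _
  refine ae_eq_of_forall_setLIntegral_eq_of_sigmaFinite hm measurable_const fun A hA _ => ?_
  rw [setLIntegral_const, one_mul]
  conv_rhs => rw [← h, Measure.map_apply hw hA, withDensity_apply _ (hw hA),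
    ← lintegral_indicator (hw hA), lintegral_block (hF.indicator (hw hA))]
  rw [← lintegral_indicator hA]
  refine lintegral_congr fun w => ?_
  by_cases hw : w ∈ A
  · simp [hw, Set.indicator, blockPoint]
  · simp [hw, Set.indicator, blockPoint]

section ProductDensity

variable {Q : ℕ} {n : Fin Q → ℕ} {F : (i : Fin Q) → ((Unit ⊕ Fin (n i)) → ℝ) → ℝ≥0∞}

lemma map_blockProj_withDensity_prod (hF : ∀ i, Measurable (F i))
    (h : ∀ i, ((cubeMeasure (Unit ⊕ Fin (n i))).withDensity (F i)).map
      (fun u => u (Sum.inl ())) = unif01) (i : Fin Q) :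
    ((cubeMeasure (FullIdx Q n)).withDensity fun u => ∏ j, F j (blockProj n j u)).map
      (blockProj n i) = (cubeMeasure (Unit ⊕ Fin (n i))).withDensity (F i) := by
  ext A hA
  have hA' := measurable_blockProj n i hA
  rw [Measure.map_apply (measurable_blockProj n i) hA, withDensity_apply _ hA',
    withDensity_apply _ hA, ← lintegral_indicator hA', ← lintegral_indicator hA,
    lintegral_block ((hF i).indicator hA)]
  set F' : (j : Fin Q) → ((Unit ⊕ Fin (n j)) → ℝ) → ℝ≥0∞ :=
    Function.update F i (A.indicator (F i)) with hF'
  have hF'm : ∀ j, Measurable (F' j) := by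
    intro j
    rcases eq_or_ne j i with rfl | hj
    · simpa [hF'] using (hF j).indicator hA
    · simpa [hF', hj] using hF j
  have key : ∀ u, (blockProj n i ⁻¹' A).indicator (fun u => ∏ j, F j (blockProj n j u)) u =
      1 * ∏ j, F' j (blockProj n j u) := by
    intro u
    have hrest : ∏ j ∈ {i}ᶜ, F' j (blockProj n j u) = ∏ j ∈ {i}ᶜ, F j (blockProj n j u) :=
      Finset.prod_congr rfl fun j hj => by
        have : j ≠ i := by simpa using hj
        simp [hF', this]
    rw [Fintype.prod_eq_mul_prod_compl i, hrest, one_mul]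
    by_cases hu : blockProj n i u ∈ A
    · rw [Set.indicator_of_mem (by exact hu), Fintype.prod_eq_mul_prod_compl i]
      simp [hF', hu]
    · rw [Set.indicator_of_notMem (by exact hu)]
      simp [hF', hu]
  simp_rw [key]
  rw [lintegral_full n (f := fun _ => 1) measurable_const hF'm]
  have hall := ae_all_iff.2 fun j => ae_lintegral_fibre_eq_one (hF j) (h j)
  refine lintegral_congr_ae (hall.mono fun w hw => ?_)
  dsimp only
  rw [one_mul, Fintype.prod_eq_mul_prod_compl i, Finset.prod_eq_one, mul_one]
  · simp [hF']
  · intro j hj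
    have : j ≠ i := by simpa using hj
    simpa [hF', this] using hw j

lemma map_inl_withDensity_prod (hF : ∀ i, Measurable (F i))
    (h : ∀ i, ((cubeMeasure (Unit ⊕ Fin (n i))).withDensity (F i)).map
      (fun u => u (Sum.inl ())) = unif01) :
    ((cubeMeasure (FullIdx Q n)).withDensity fun u => ∏ j, F j (blockProj n j u)).map
      (fun u => u (Sum.inl ())) = unif01 := by
  ext A hA
  have hproj : Measurable fun u : FullIdx Q n → ℝ => u (Sum.inl ()) := measurable_pi_apply _
  have hA' := hproj hA
  rw [Measure.map_apply hproj hA, withDensity_apply _ hA',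
    ← lintegral_indicator hA']
  have key : ∀ u : FullIdx Q n → ℝ, ((fun u : FullIdx Q n → ℝ => u (Sum.inl ())) ⁻¹' A).indicator
      (fun u => ∏ j, F j (blockProj n j u)) u =
      A.indicator 1 (u (Sum.inl ())) * ∏ j, F j (blockProj n j u) := by
    intro u
    by_cases hu : u (Sum.inl ()) ∈ A
    · simp [Set.indicator, hu]
    · simp [Set.indicator, hu]
  simp_rw [key]
  rw [lintegral_full n (measurable_one.indicator hA) hF, ← lintegral_indicator_one hA]
  have hall := ae_all_iff.2 fun j => ae_lintegral_fibre_eq_one (hF j) (h j)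
  refine lintegral_congr_ae (hall.mono fun w hw => ?_)
  dsimp only
  rw [Finset.prod_eq_one fun j _ => hw j, mul_one]

lemma isCopulaI_of_absolutelyContinuous {ι : Type*} [Fintype ι] {P : Measure (ι → ℝ)}
    (hp : IsProbabilityMeasure P) (hac : P ≪ cubeMeasure ι)
    (hmarg : ∀ i, P.map (fun u => u i) = unif01) : IsCopulaI P where
  prob := hp
  ac := hac.trans Measure.restrict_le_self.absolutelyContinuous
  mass := by
    rw [← prob_compl_eq_zero_iff (measurableSet_CubeI ι)]
    refine hac ?_
    simp [cubeMeasure, measurableSet_CubeI ι |>.compl]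
  marg := hmarg

lemma isCopulaI_withDensity_prod (hF : ∀ i, Measurable (F i))
    (h : ∀ i, IsCopulaI ((cubeMeasure (Unit ⊕ Fin (n i))).withDensity (F i))) :
    IsCopulaI ((cubeMeasure (FullIdx Q n)).withDensity fun u => ∏ j, F j (blockProj n j u)) := by
  have hw := map_inl_withDensity_prod hF fun i => (h i).marg _
  refine isCopulaI_of_absolutelyContinuous ?_ (withDensity_absolutelyContinuous _ _) ?_
  · refine ⟨?_⟩
    have hproj : Measurable fun u : FullIdx Q n → ℝ => u (Sum.inl ()) := measurable_pi_apply _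
    rw [← measure_univ (μ := unif01), ← hw, Measure.map_apply hproj .univ, Set.preimage_univ]
  · rintro (_ | ⟨i, k⟩)
    · exact hw
    · rw [← (h i).marg (Sum.inr k), ← map_blockProj_withDensity_prod hF (fun i => (h i).marg _) i,
        Measure.map_map (measurable_pi_apply _) (measurable_blockProj n i)]
      rfl

end ProductDensity

lemma measurePreserving_blockProj {Q : ℕ} (n : Fin Q → ℕ) (i : Fin Q) :
    MeasurePreserving (blockProj n i) (cubeMeasure (FullIdx Q n))
      (cubeMeasure (Unit ⊕ Fin (n i))) := by
  refine ⟨measurable_blockProj n i, ?_⟩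
  have := map_blockProj_withDensity_prod (n := n) (F := fun _ _ => 1) (fun _ => measurable_const)
    (fun i => ?_) i
  · simpa [← Pi.one_def] using this
  · change (Measure.withDensity _ 1).map _ = _
    rw [withDensity_one, cubeMeasure_eq_pi]
    exact (measurePreserving_eval (fun _ => unif01) (Sum.inl () : Unit ⊕ Fin (n i))).map_eq

section Gibbs

lemma mul_div_eq_indicator {α : Type*} {p g : α → ℝ} (hp : ∀ x, 0 ≤ p x) :
    (fun x => p x * (g x / p x)) = {x | 0 < p x}.indicator g := by
  funext x
  rcases (hp x).eq_or_lt with h | h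
  · simp [← h]
  · rw [Set.indicator_of_mem (by exact h), mul_div_cancel₀ _ h.ne']

variable {α : Type*} [MeasurableSpace α] {ν : Measure α} {p g : α → ℝ}

lemma integrable_withDensity_ofReal_iff (hp : Measurable p) (hp0 : ∀ x, 0 ≤ p x) {f : α → ℝ} :
    Integrable f (ν.withDensity fun x => ENNReal.ofReal (p x)) ↔
      Integrable (fun x => p x * f x) ν := by
  rw [integrable_withDensity_iff_integrable_smul' hp.ennreal_ofReal (by simp)]
  simp [ENNReal.toReal_ofReal (hp0 _)]

lemma integral_withDensity_ofReal (hp : Measurable p) (hp0 : ∀ x, 0 ≤ p x) (f : α → ℝ) :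
    ∫ x, f x ∂(ν.withDensity fun x => ENNReal.ofReal (p x)) = ∫ x, p x * f x ∂ν := by
  rw [integral_withDensity_eq_integral_toReal_smul hp.ennreal_ofReal (by simp)]
  simp [ENNReal.toReal_ofReal (hp0 _)]

lemma ae_withDensity_ofReal_pos (hp : Measurable p) :
    ∀ᵐ x ∂(ν.withDensity fun x => ENNReal.ofReal (p x)), 0 < p x := by
  rw [ae_withDensity_iff hp.ennreal_ofReal]
  exact .of_forall fun x hx => by simpa using hx

lemma integrable_div_withDensity (hp : Measurable p) (hp0 : ∀ x, 0 ≤ p x)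
    (hg : Integrable g ν) :
    Integrable (fun x => g x / p x) (ν.withDensity fun x => ENNReal.ofReal (p x)) := by
  rw [integrable_withDensity_ofReal_iff hp hp0, mul_div_eq_indicator hp0]
  exact hg.indicator (measurableSet_lt measurable_const hp)

lemma integral_div_withDensity_le (hp : Measurable p) (hp0 : ∀ x, 0 ≤ p x)
    (hg : Integrable g ν) (hg0 : ∀ x, 0 ≤ g x) :
    ∫ x, g x / p x ∂(ν.withDensity fun x => ENNReal.ofReal (p x)) ≤ ∫ x, g x ∂ν := by
  rw [integral_withDensity_ofReal hp hp0, mul_div_eq_indicator hp0,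
    integral_indicator (measurableSet_lt measurable_const hp)]
  exact setIntegral_le_integral hg (.of_forall hg0)

lemma log_sub_log_le {x y : ℝ} (hx : 0 < x) (hy : 0 < y) :
    Real.log y - Real.log x ≤ y / x - 1 := by
  rw [← Real.log_div hy.ne' hx.ne']
  exact Real.log_le_sub_one_of_pos (div_pos hy hx)

lemma integral_log_le_integral_log (hp : Measurable p) (hp0 : ∀ x, 0 ≤ p x)
    (hP : IsProbabilityMeasure (ν.withDensity fun x => ENNReal.ofReal (p x)))
    (hg : Integrable g ν) (hg0 : ∀ x, 0 ≤ g x) (hg1 : ∫ x, g x ∂ν ≤ 1)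
    (hgpos : ∀ᵐ x ∂(ν.withDensity fun x => ENNReal.ofReal (p x)), 0 < g x)
    (hlp : Integrable (fun x => Real.log (p x)) (ν.withDensity fun x => ENNReal.ofReal (p x)))
    (hlg : Integrable (fun x => Real.log (g x)) (ν.withDensity fun x => ENNReal.ofReal (p x))) :
    ∫ x, Real.log (g x) ∂(ν.withDensity fun x => ENNReal.ofReal (p x)) ≤
      ∫ x, Real.log (p x) ∂(ν.withDensity fun x => ENNReal.ofReal (p x)) := by
  have hdiv := integrable_div_withDensity hp hp0 hg
  have h : ∫ x, (Real.log (g x) - Real.log (p x)) ∂(ν.withDensity fun x => ENNReal.ofReal (p x)) ≤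
      ∫ x, (g x / p x - 1) ∂(ν.withDensity fun x => ENNReal.ofReal (p x)) := by
    refine integral_mono_ae (hlg.sub hlp) (hdiv.sub (integrable_const 1)) ?_
    filter_upwards [hgpos, ae_withDensity_ofReal_pos hp] with x hgx hpx
    exact log_sub_log_le hpx hgx
  rw [integral_sub hlg hlp, integral_sub hdiv (integrable_const 1)] at h
  have := integral_div_withDensity_le hp hp0 hg hg0
  simp at h
  linarith

lemma integrable_log_of_integrable_inv (hp : Measurable p) (hp0 : ∀ x, 0 ≤ p x)
    (hg : Integrable g ν) (hgm : Measurable g)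
    (hgpos : ∀ᵐ x ∂(ν.withDensity fun x => ENNReal.ofReal (p x)), 0 < g x)
    (hlp : Integrable (fun x => Real.log (p x)) (ν.withDensity fun x => ENNReal.ofReal (p x)))
    (hinv : Integrable (fun x => 1 / g x) (ν.withDensity fun x => ENNReal.ofReal (p x))) :
    Integrable (fun x => Real.log (g x)) (ν.withDensity fun x => ENNReal.ofReal (p x)) := by
  refine ((hlp.abs.add (integrable_div_withDensity hp hp0 hg)).add hinv).mono'
    (Real.measurable_log.comp hgm).aestronglyMeasurable ?_
  filter_upwards [hgpos, ae_withDensity_ofReal_pos hp] with x hgx hpx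
  have h1 := log_sub_log_le hpx hgx
  have h2 := log_sub_log_le hgx one_pos
  have h3 := div_pos hgx hpx
  have h4 := one_div_pos.2 hgx
  have h5 := le_abs_self (Real.log (p x))
  have h6 := abs_nonneg (Real.log (p x))
  rw [Real.log_one] at h2
  simp only [Pi.add_apply, Real.norm_eq_abs, abs_le]
  constructor <;> linarith

lemma add_div_two_mul_log_le {x y : ℝ} (hx : 0 ≤ x) (hy : 0 ≤ y) :
    (x + y) / 2 * Real.log ((x + y) / 2) ≤ (x * Real.log x + y * Real.log y) / 2 := by
  have := Real.convexOn_mul_log.2 (Set.mem_Ici.2 hx) (Set.mem_Ici.2 hy) (one_half_pos (α := ℝ)).le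
    (one_half_pos (α := ℝ)).le (add_halves 1)
  simp only [smul_eq_mul] at this
  rw [show (x + y) / 2 = 1 / 2 * x + 1 / 2 * y by ring]
  linarith

lemma eq_of_le_add_div_two_mul_log {x y : ℝ} (hx : 0 ≤ x) (hy : 0 ≤ y)
    (h : (x * Real.log x + y * Real.log y) / 2 ≤ (x + y) / 2 * Real.log ((x + y) / 2)) :
    x = y := by
  by_contra hne
  have := Real.strictConvexOn_mul_log.2 hx hy hne one_half_pos one_half_pos (add_halves 1)
  simp only [smul_eq_mul] at this
  rw [show (x + y) / 2 = 1 / 2 * x + 1 / 2 * y by ring] at h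
  linarith

lemma integrable_midpoint_mul_log [IsFiniteMeasure ν] (hp : Measurable p) (hp0 : ∀ x, 0 ≤ p x)
    (hg : Measurable g) (hg0 : ∀ x, 0 ≤ g x)
    (hip : Integrable (fun x => p x * Real.log (p x)) ν)
    (hig : Integrable (fun x => g x * Real.log (g x)) ν) :
    Integrable (fun x => (p x + g x) / 2 * Real.log ((p x + g x) / 2)) ν := by
  have hm : Measurable fun x => (p x + g x) / 2 := (hp.add hg).div_const 2
  refine ((hip.abs.add hig.abs).add (integrable_const 1)).mono'
    (hm.mul (Real.measurable_log.comp hm)).aestronglyMeasurable (.of_forall fun x => ?_)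
  have h1 := add_div_two_mul_log_le (hp0 x) (hg0 x)
  have h2 : -1 ≤ (p x + g x) / 2 * Real.log ((p x + g x) / 2) := by
    have hm0 : 0 ≤ (p x + g x) / 2 := by linarith [hp0 x, hg0 x]
    rcases hm0.eq_or_lt with h | h
    · rw [← h]; norm_num
    · have := mul_le_mul_of_nonneg_left (Real.one_sub_inv_le_log_of_pos h) hm0
      rw [mul_sub, mul_inv_cancel₀ h.ne'] at this
      linarith
  have h3 := le_abs_self (p x * Real.log (p x))
  have h4 := le_abs_self (g x * Real.log (g x))
  have h5 := abs_nonneg (p x * Real.log (p x))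
  have h6 := abs_nonneg (g x * Real.log (g x))
  simp only [Pi.add_apply, Real.norm_eq_abs, abs_le]
  constructor <;> linarith

lemma ae_eq_of_integral_le_integral_midpoint [IsFiniteMeasure ν] (hp : Measurable p)
    (hp0 : ∀ x, 0 ≤ p x) (hg : Measurable g) (hg0 : ∀ x, 0 ≤ g x)
    (hip : Integrable (fun x => p x * Real.log (p x)) ν)
    (hig : Integrable (fun x => g x * Real.log (g x)) ν)
    (h : (∫ x, p x * Real.log (p x) ∂ν + ∫ x, g x * Real.log (g x) ∂ν) / 2 ≤
      ∫ x, (p x + g x) / 2 * Real.log ((p x + g x) / 2) ∂ν) :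
    p =ᵐ[ν] g := by
  have him := integrable_midpoint_mul_log hp hp0 hg hg0 hip hig
  have hia : Integrable (fun x => (p x * Real.log (p x) + g x * Real.log (g x)) / 2) ν :=
    (hip.add hig).div_const 2
  have hle := fun x => add_div_two_mul_log_le (hp0 x) (hg0 x)
  have heq : ∫ x, (p x + g x) / 2 * Real.log ((p x + g x) / 2) ∂ν =
      ∫ x, (p x * Real.log (p x) + g x * Real.log (g x)) / 2 ∂ν := by
    refine (integral_mono him hia hle).antisymm ?_
    rwa [integral_div, integral_add hip hig]
  have := (integral_eq_iff_of_ae_le him hia (.of_forall hle)).1 heq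
  filter_upwards [this] with x hx
  exact eq_of_le_add_div_two_mul_log (hp0 x) (hg0 x) hx.ge

end Gibbs

section Entropy

variable {ι : Type*} [Fintype ι] {p : (ι → ℝ) → ℝ}

lemma dens_withDensity_cubeMeasure (hp : Measurable p) (hp0 : ∀ x, 0 ≤ p x) :
    dens ((cubeMeasure ι).withDensity fun x => ENNReal.ofReal (p x)) =ᵐ[volume]
      (CubeI ι).indicator p := by
  have hC := measurableSet_CubeI ι
  have hm : Measurable ((CubeI ι).indicator fun x => ENNReal.ofReal (p x)) :=
    hp.ennreal_ofReal.indicator hC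
  rw [cubeMeasure, ← withDensity_indicator hC]
  filter_upwards [Measure.rnDeriv_withDensity volume hm] with x hx
  rw [dens, hx]
  by_cases h : x ∈ CubeI ι <;> simp [h, hp0 x]

lemma dens_mul_log_dens_withDensity (hp : Measurable p) (hp0 : ∀ x, 0 ≤ p x) :
    (fun x => dens ((cubeMeasure ι).withDensity fun x => ENNReal.ofReal (p x)) x *
      Real.log (dens ((cubeMeasure ι).withDensity fun x => ENNReal.ofReal (p x)) x)) =ᵐ[volume]
      (CubeI ι).indicator fun x => p x * Real.log (p x) := by
  filter_upwards [dens_withDensity_cubeMeasure hp hp0] with x hx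
  rw [hx]
  by_cases h : x ∈ CubeI ι <;> simp [h]

lemma finiteEnt_withDensity_iff_integrable (hp : Measurable p) (hp0 : ∀ x, 0 ≤ p x) :
    FiniteEnt ((cubeMeasure ι).withDensity fun x => ENNReal.ofReal (p x)) ↔
      Integrable (fun x => p x * Real.log (p x)) (cubeMeasure ι) := by
  rw [FiniteEnt, integrable_congr (dens_mul_log_dens_withDensity hp hp0),
    integrable_indicator_iff (measurableSet_CubeI ι)]
  rfl

lemma diffEnt_withDensity_eq (hp : Measurable p) (hp0 : ∀ x, 0 ≤ p x) :
    diffEnt ((cubeMeasure ι).withDensity fun x => ENNReal.ofReal (p x)) =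
      - ∫ x, p x * Real.log (p x) ∂cubeMeasure ι := by
  rw [diffEnt, integral_congr_ae (dens_mul_log_dens_withDensity hp hp0),
    integral_indicator (measurableSet_CubeI ι)]
  rfl

lemma finiteEnt_withDensity_iff_integrable_log (hp : Measurable p) (hp0 : ∀ x, 0 ≤ p x) :
    FiniteEnt ((cubeMeasure ι).withDensity fun x => ENNReal.ofReal (p x)) ↔
      Integrable (fun x => Real.log (p x))
        ((cubeMeasure ι).withDensity fun x => ENNReal.ofReal (p x)) := by
  rw [finiteEnt_withDensity_iff_integrable hp hp0, integrable_withDensity_ofReal_iff hp hp0]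

lemma diffEnt_withDensity_eq_log (hp : Measurable p) (hp0 : ∀ x, 0 ≤ p x) :
    diffEnt ((cubeMeasure ι).withDensity fun x => ENNReal.ofReal (p x)) =
      - ∫ x, Real.log (p x) ∂((cubeMeasure ι).withDensity fun x => ENNReal.ofReal (p x)) := by
  rw [diffEnt_withDensity_eq hp hp0, integral_withDensity_ofReal hp hp0]

lemma IsCopulaI.exists_density {P : Measure (ι → ℝ)} (hP : IsCopulaI P) :
    ∃ p : (ι → ℝ) → ℝ, Measurable p ∧ (∀ x, 0 ≤ p x) ∧
      P = (cubeMeasure ι).withDensity fun x => ENNReal.ofReal (p x) := by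
  have := hP.prob
  have hC := measurableSet_CubeI ι
  refine ⟨dens P, (Measure.measurable_rnDeriv _ _).ennreal_toReal,
    fun _ => ENNReal.toReal_nonneg, ?_⟩
  have hr : P.restrict (CubeI ι) = P :=
    Measure.restrict_eq_self_of_ae_mem ((prob_compl_eq_zero_iff hC).2 hP.mass)
  conv_lhs => rw [← hr, ← Measure.withDensity_rnDeriv_eq P volume hP.ac, restrict_withDensity hC]
  refine withDensity_congr_ae (ae_restrict_of_ae ?_)
  filter_upwards [Measure.rnDeriv_lt_top P volume] with x hx
  exact (ENNReal.ofReal_toReal hx.ne).symm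

lemma integral_ofReal_density_eq_one (hp : Measurable p) (hp0 : ∀ x, 0 ≤ p x)
    (hP : IsProbabilityMeasure ((cubeMeasure ι).withDensity fun x => ENNReal.ofReal (p x))) :
    Integrable p (cubeMeasure ι) ∧ ∫ x, p x ∂cubeMeasure ι = 1 := by
  constructor
  · simpa using (integrable_withDensity_ofReal_iff hp hp0).1 (integrable_const (1 : ℝ))
  · simpa using (integral_withDensity_ofReal (ν := cubeMeasure ι) hp hp0 fun _ => 1).symm

end Entropy

section BlockMarginals

variable {Q : ℕ} {n : Fin Q → ℕ}

lemma IsCopulaI.map_blockProj {P : Measure (FullIdx Q n → ℝ)} (hP : IsCopulaI P) (i : Fin Q) :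
    IsCopulaI (P.map (blockProj n i)) := by
  have := hP.prob
  have hm := measurable_blockProj n i
  obtain ⟨p, -, -, hPp⟩ := hP.exists_density
  refine isCopulaI_of_absolutelyContinuous (Measure.isProbabilityMeasure_map hm.aemeasurable)
    ?_ fun j => ?_
  · rw [← (measurePreserving_blockProj n i).map_eq]
    refine Measure.AbsolutelyContinuous.map ?_ hm
    rw [hPp]
    exact withDensity_absolutelyContinuous _ _
  · rw [Measure.map_map (measurable_pi_apply _) hm]
    rcases j with _ | k
    · exact hP.marg _
    · exact hP.marg _

lemma ofReal_prod_blockProj {q : (i : Fin Q) → ((Unit ⊕ Fin (n i)) → ℝ) → ℝ}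
    (hq0 : ∀ i x, 0 ≤ q i x) :
    (fun u : FullIdx Q n → ℝ => ENNReal.ofReal (∏ i, q i (blockProj n i u))) =
      fun u => ∏ i, ENNReal.ofReal (q i (blockProj n i u)) :=
  funext fun _ => ENNReal.ofReal_prod_of_nonneg fun i _ => hq0 i _

variable {q : (i : Fin Q) → ((Unit ⊕ Fin (n i)) → ℝ) → ℝ} {P : Measure (FullIdx Q n → ℝ)}

lemma ae_blockProj_density_pos (hq : ∀ i, Measurable (q i))
    (hPq : ∀ i, P.map (blockProj n i) =
      (cubeMeasure (Unit ⊕ Fin (n i))).withDensity fun x => ENNReal.ofReal (q i x)) :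
    ∀ᵐ u ∂P, ∀ i, 0 < q i (blockProj n i u) := by
  refine ae_all_iff.2 fun i => ?_
  have h := ae_withDensity_ofReal_pos (ν := cubeMeasure (Unit ⊕ Fin (n i))) (hq i)
  rw [← hPq i] at h
  exact ae_of_ae_map (measurable_blockProj n i).aemeasurable h

lemma log_prod_blockProj_ae_eq (hq : ∀ i, Measurable (q i))
    (hPq : ∀ i, P.map (blockProj n i) =
      (cubeMeasure (Unit ⊕ Fin (n i))).withDensity fun x => ENNReal.ofReal (q i x)) :
    (fun u => Real.log (∏ i, q i (blockProj n i u))) =ᵐ[P]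
      fun u => ∑ i, Real.log (q i (blockProj n i u)) := by
  filter_upwards [ae_blockProj_density_pos hq hPq] with u hu
  exact Real.log_prod fun i _ => (hu i).ne'

/-- If every block marginal of `P` has density `q i` and finite entropy, then the cross entropy of
`P` relative to the product of the `q i` is the sum of the block entropies. -/
lemma integral_log_prod_blockProj (hq : ∀ i, Measurable (q i)) (hq0 : ∀ i x, 0 ≤ q i x)
    (hPq : ∀ i, P.map (blockProj n i) =
      (cubeMeasure (Unit ⊕ Fin (n i))).withDensity fun x => ENNReal.ofReal (q i x))
    (hfin : ∀ i, FiniteEnt (P.map (blockProj n i))) :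
    Integrable (fun u => Real.log (∏ i, q i (blockProj n i u))) P ∧
      ∫ u, Real.log (∏ i, q i (blockProj n i u)) ∂P =
        - ∑ i, diffEnt (P.map (blockProj n i)) := by
  have hint : ∀ i, Integrable (fun u => Real.log (q i (blockProj n i u))) P := by
    intro i
    have h := hfin i
    rw [hPq i, finiteEnt_withDensity_iff_integrable_log (hq i) (hq0 i), ← hPq i] at h
    exact h.comp_measurable (measurable_blockProj n i)
  have hae := log_prod_blockProj_ae_eq hq hPq
  refine ⟨(integrable_finsetSum _ fun i _ => hint i).congr hae.symm, ?_⟩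
  rw [integral_congr_ae hae, integral_finsetSum _ fun i _ => hint i, ← Finset.sum_neg_distrib]
  refine Finset.sum_congr rfl fun i _ => ?_
  rw [hPq i, diffEnt_withDensity_eq_log (hq i) (hq0 i), neg_neg, ← hPq i]
  exact (integral_map (measurable_blockProj n i).aemeasurable
    (Real.measurable_log.comp (hq i)).aestronglyMeasurable).symm

lemma IsCopulaI.finiteEnt_map_blockProj (hP : IsCopulaI P) (hfin : FiniteEnt P) (i : Fin Q) :
    FiniteEnt (P.map (blockProj n i)) := by
  have hm := measurable_blockProj n i
  obtain ⟨p, hp, hp0, rfl⟩ := hP.exists_density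
  obtain ⟨q, hq, hq0, hPq⟩ := (hP.map_blockProj i).exists_density
  have hprob := (hP.map_blockProj i).prob
  rw [finiteEnt_withDensity_iff_integrable_log hp hp0] at hfin
  rw [hPq] at hprob
  have hinv := integrable_div_withDensity (ν := cubeMeasure (Unit ⊕ Fin (n i))) hq hq0
    (integrable_const (1 : ℝ))
  have hpos := ae_withDensity_ofReal_pos (ν := cubeMeasure (Unit ⊕ Fin (n i))) hq
  have hqi := (integral_ofReal_density_eq_one hq hq0 hprob).1
  rw [hPq, finiteEnt_withDensity_iff_integrable_log hq hq0]
  rw [← hPq] at hinv hpos ⊢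
  refine (integrable_map_measure (Real.measurable_log.comp hq).aestronglyMeasurable
    hm.aemeasurable).2 ?_
  exact integrable_log_of_integrable_inv hp hp0
    ((measurePreserving_blockProj n i).integrable_comp_of_integrable hqi) (hq.comp hm)
    (ae_of_ae_map hm.aemeasurable hpos) hfin (hinv.comp_measurable hm)

/-- Subadditivity of entropy for copulas, conditionally on the shared coordinate. -/
lemma IsCopulaI.diffEnt_le_sum (hP : IsCopulaI P) (hfin : FiniteEnt P) :
    diffEnt P ≤ ∑ i, diffEnt (P.map (blockProj n i)) := by
  have hfin' := hP.finiteEnt_map_blockProj hfin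
  choose q hq hq0 hPq using fun i => (hP.map_blockProj i).exists_density
  obtain ⟨hint, heq⟩ := integral_log_prod_blockProj hq hq0 hPq hfin'
  have hG := isCopulaI_withDensity_prod (fun i => (hq i).ennreal_ofReal)
    fun i => hPq i ▸ hP.map_blockProj i
  rw [← ofReal_prod_blockProj hq0] at hG
  have hgm : Measurable fun u : FullIdx Q n → ℝ => ∏ i, q i (blockProj n i u) :=
    Finset.measurable_prod _ fun i _ => (hq i).comp (measurable_blockProj n i)
  have hg0 : ∀ u : FullIdx Q n → ℝ, 0 ≤ ∏ i, q i (blockProj n i u) :=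
    fun u => Finset.prod_nonneg fun i _ => hq0 i _
  obtain ⟨hgi, hg1⟩ := integral_ofReal_density_eq_one hgm hg0 hG.prob
  have hpos := ae_blockProj_density_pos hq hPq
  obtain ⟨p, hp, hp0, rfl⟩ := hP.exists_density
  have := integral_log_le_integral_log hp hp0 hP.prob hgi hg0 hg1.le
    (hpos.mono fun u hu => Finset.prod_pos fun i _ => hu i)
    ((finiteEnt_withDensity_iff_integrable_log hp hp0).1 hfin) hint
  rw [diffEnt_withDensity_eq_log hp hp0]
  linarith

end BlockMarginals

section Midpoint

variable {ι : Type*} [Fintype ι] {p g : (ι → ℝ) → ℝ}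

lemma withDensity_midpoint (hp : Measurable p) (hp0 : ∀ x, 0 ≤ p x) (hg : Measurable g)
    (hg0 : ∀ x, 0 ≤ g x) :
    (cubeMeasure ι).withDensity (fun x => ENNReal.ofReal ((p x + g x) / 2)) =
      (2⁻¹ : ℝ≥0∞) • ((cubeMeasure ι).withDensity fun x => ENNReal.ofReal (p x)) +
        (2⁻¹ : ℝ≥0∞) • ((cubeMeasure ι).withDensity fun x => ENNReal.ofReal (g x)) := by
  rw [← withDensity_smul _ hp.ennreal_ofReal, ← withDensity_smul _ hg.ennreal_ofReal,
    ← withDensity_add_left (hp.ennreal_ofReal.const_smul _)]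
  congr 1
  funext x
  simp only [Pi.add_apply, Pi.smul_apply, smul_eq_mul]
  rw [← mul_add, ← ENNReal.ofReal_add (hp0 x) (hg0 x), div_eq_inv_mul,
    ENNReal.ofReal_mul (by norm_num), ENNReal.ofReal_inv_of_pos two_pos, ENNReal.ofReal_ofNat]

lemma IsCopulaI.midpoint {P G : Measure (ι → ℝ)} (hP : IsCopulaI P) (hG : IsCopulaI G) :
    IsCopulaI ((2⁻¹ : ℝ≥0∞) • P + (2⁻¹ : ℝ≥0∞) • G) where
  prob := ⟨by
    have := hP.prob
    have := hG.prob
    simp [ENNReal.inv_two_add_inv_two]⟩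
  ac := Measure.AbsolutelyContinuous.add_left (hP.ac.smul_left _) (hG.ac.smul_left _)
  mass := by simp [hP.mass, hG.mass, ENNReal.inv_two_add_inv_two]
  marg i := by
    rw [Measure.map_add _ _ (measurable_pi_apply i), Measure.map_smul, Measure.map_smul,
      hP.marg, hG.marg, ← add_smul, ENNReal.inv_two_add_inv_two, one_smul]

lemma integral_midpoint {α : Type*} [MeasurableSpace α] {P G : Measure α} {f : α → ℝ} {b : ℝ}
    (hfP : Integrable f P) (hfG : Integrable f G) (hP : ∫ x, f x ∂P = b) (hG : ∫ x, f x ∂G = b) :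
    ∫ x, f x ∂((2⁻¹ : ℝ≥0∞) • P + (2⁻¹ : ℝ≥0∞) • G) = b := by
  rw [integral_add_measure (hfP.smul_measure (by simp)) (hfG.smul_measure (by simp)),
    integral_smul_measure, integral_smul_measure, hP, hG]
  simp
  ring

/-- By strict concavity, the differential entropy has at most one maximizer among the copulas
satisfying a family of moment constraints. -/
lemma IsCopulaI.eq_of_maximal {κ : Type*} {P G : Measure (ι → ℝ)} (hP : IsCopulaI P)
    (hG : IsCopulaI G) (hPfin : FiniteEnt P) (hGfin : FiniteEnt G)
    {f : κ → (ι → ℝ) → ℝ} {b : κ → ℝ}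
    (hfi : ∀ P, IsCopulaI P → ∀ k, Integrable (f k) P)
    (hPf : ∀ k, ∫ x, f k x ∂P = b k) (hGf : ∀ k, ∫ x, f k x ∂G = b k)
    (hPmax : ∀ P', IsCopulaI P' → (∀ k, ∫ x, f k x ∂P' = b k) → FiniteEnt P' →
      diffEnt P' ≤ diffEnt P)
    (hGmax : ∀ P', IsCopulaI P' → (∀ k, ∫ x, f k x ∂P' = b k) → FiniteEnt P' →
      diffEnt P' ≤ diffEnt G) : P = G := by
  have hM := hP.midpoint hG
  have hMf := fun k => integral_midpoint (hfi P hP k) (hfi G hG k) (hPf k) (hGf k)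
  obtain ⟨p, hp, hp0, rfl⟩ := hP.exists_density
  obtain ⟨g, hg, hg0, rfl⟩ := hG.exists_density
  have hm : Measurable fun x => (p x + g x) / 2 := (hp.add hg).div_const 2
  have hm0 : ∀ x, 0 ≤ (p x + g x) / 2 := fun x => by linarith [hp0 x, hg0 x]
  rw [finiteEnt_withDensity_iff_integrable hp hp0] at hPfin
  rw [finiteEnt_withDensity_iff_integrable hg hg0] at hGfin
  rw [← withDensity_midpoint hp hp0 hg hg0] at hM hMf
  have hMfin := (finiteEnt_withDensity_iff_integrable hm hm0).2
    (integrable_midpoint_mul_log hp hp0 hg hg0 hPfin hGfin)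
  have h1 := hPmax _ hM hMf hMfin
  have h2 := hGmax _ hM hMf hMfin
  rw [diffEnt_withDensity_eq hm hm0] at h1 h2
  rw [diffEnt_withDensity_eq hp hp0] at h1
  rw [diffEnt_withDensity_eq hg hg0] at h2
  refine withDensity_congr_ae ?_
  filter_upwards [ae_eq_of_integral_le_integral_midpoint hp hp0 hg hg0 hPfin hGfin
    (by linarith)] with x hx
  rw [hx]

end Midpoint

lemma IsCopulaI.integrable_of_bounded {ι : Type*} [Fintype ι] {P : Measure (ι → ℝ)}
    (hP : IsCopulaI P) {f : (ι → ℝ) → ℝ} (hf : Measurable f) {C : ℝ}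
    (hC : ∀ v ∈ CubeI ι, |f v| ≤ C) : Integrable f P := by
  have := hP.prob
  have hmem : ∀ᵐ v ∂P, v ∈ CubeI ι := (prob_compl_eq_zero_iff (measurableSet_CubeI ι)).2 hP.mass
  exact (integrable_const C).mono' hf.aestronglyMeasurable (hmem.mono hC)

/-- Iterative MIND, sparse case (Theorem `sparse_1`): the product of the per-block
maximum-entropy copula densities is the maximum-entropy copula density under the combined
constraints, and its entropy is the sum of the per-block entropies. -/
theorem iterative_mind_sparse {Q : ℕ} (n : Fin Q → ℕ) (r : Fin Q → ℕ) [∀ i, NeZero (r i)]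
    (η : (i : Fin Q) → ((Unit ⊕ Fin (n i)) → ℝ) → Fin (r i) → ℝ)
    (hηc : ∀ i, Continuous (η i))
    (hηb : ∀ i, ∃ C, ∀ v ∈ CubeI (Unit ⊕ Fin (n i)), ∀ j, |η i v j| ≤ C)
    (hη1 : ∀ i v, η i v 0 = 1)
    (hηli : ∀ i (θ : Fin (r i) → ℝ),
      (∀ᵐ v ∂volume.restrict (CubeI (Unit ⊕ Fin (n i))), ∑ j, θ j * η i v j = 0) → θ = 0)
    (β : (i : Fin Q) → Fin (r i) → ℝ)
    -- the per-block maximum-entropy copulas `Q_i`, with densities `q_i`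
    (Qm : (i : Fin Q) → Measure ((Unit ⊕ Fin (n i)) → ℝ))
    (qd : (i : Fin Q) → ((Unit ⊕ Fin (n i)) → ℝ) → ℝ)
    (hqdm : ∀ i, Measurable (qd i)) (hqd0 : ∀ i v, 0 ≤ qd i v)
    (hQd : ∀ i, Qm i = (volume.restrict (CubeI (Unit ⊕ Fin (n i)))).withDensity
      (fun v => ENNReal.ofReal (qd i v)))
    (hQcop : ∀ i, IsCopulaI (Qm i))
    (hQcons : ∀ i j, ∫ v, η i v j ∂(Qm i) = β i j)
    (hQfin : ∀ i, FiniteEnt (Qm i))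
    (hQmax : ∀ i, ∀ P : Measure ((Unit ⊕ Fin (n i)) → ℝ), IsCopulaI P →
      (∀ j, ∫ v, η i v j ∂P = β i j) → FiniteEnt P → diffEnt P ≤ diffEnt (Qm i)) :
    -- `g(u) = ∏ᵢ qᵢ(w, vᵢ)` is a copula density on `[0,1]^d` …
    IsCopulaI ((volume.restrict (CubeI (FullIdx Q n))).withDensity
        (fun u => ENNReal.ofReal (∏ i, qd i (blockProj n i u)))) ∧
    -- … the corresponding distribution satisfies all the constraints …
    (∀ i j, ∫ u, η i (blockProj n i u) j
        ∂((volume.restrict (CubeI (FullIdx Q n))).withDensity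
          (fun u => ENNReal.ofReal (∏ i, qd i (blockProj n i u)))) = β i j) ∧
    -- … it is the unique maximum-entropy copula under the combined constraints …
    (FiniteEnt ((volume.restrict (CubeI (FullIdx Q n))).withDensity
        (fun u => ENNReal.ofReal (∏ i, qd i (blockProj n i u)))) ∧
      (∀ P : Measure (FullIdx Q n → ℝ), IsCopulaI P →
        (∀ i j, ∫ u, η i (blockProj n i u) j ∂P = β i j) → FiniteEnt P →
        diffEnt P ≤ diffEnt ((volume.restrict (CubeI (FullIdx Q n))).withDensity
          (fun u => ENNReal.ofReal (∏ i, qd i (blockProj n i u))))) ∧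
      (∀ P : Measure (FullIdx Q n → ℝ), IsCopulaI P →
        (∀ i j, ∫ u, η i (blockProj n i u) j ∂P = β i j) → FiniteEnt P →
        (∀ P' : Measure (FullIdx Q n → ℝ), IsCopulaI P' →
          (∀ i j, ∫ u, η i (blockProj n i u) j ∂P' = β i j) → FiniteEnt P' →
          diffEnt P' ≤ diffEnt P) →
        P = (volume.restrict (CubeI (FullIdx Q n))).withDensity
          (fun u => ENNReal.ofReal (∏ i, qd i (blockProj n i u))))) ∧
    -- … and its differential entropy is the sum of the per-block entropies.
    diffEnt ((volume.restrict (CubeI (FullIdx Q n))).withDensity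
        (fun u => ENNReal.ofReal (∏ i, qd i (blockProj n i u)))) = ∑ i, diffEnt (Qm i) := by
  generalize hGdef : (volume.restrict (CubeI (FullIdx Q n))).withDensity
    (fun u => ENNReal.ofReal (∏ i, qd i (blockProj n i u))) = G
  have hm := measurable_blockProj n
  have hηm : ∀ i j, Measurable fun v => η i v j := fun i j =>
    (measurable_pi_apply j).comp (hηc i).measurable
  have hQd' : ∀ i, Qm i = (cubeMeasure (Unit ⊕ Fin (n i))).withDensity
      fun v => ENNReal.ofReal (qd i v) := hQd
  have hQcop' : ∀ i, IsCopulaI ((cubeMeasure (Unit ⊕ Fin (n i))).withDensity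
      fun v => ENNReal.ofReal (qd i v)) := fun i => hQd' i ▸ hQcop i
  have hG : G = (cubeMeasure (FullIdx Q n)).withDensity
      fun u => ENNReal.ofReal (∏ i, qd i (blockProj n i u)) := hGdef.symm
  have hGcop : IsCopulaI G := by
    rw [hG, ofReal_prod_blockProj hqd0]
    exact isCopulaI_withDensity_prod (F := fun i x => ENNReal.ofReal (qd i x))
      (fun i => (hqdm i).ennreal_ofReal) hQcop'
  have hGmap : ∀ i, G.map (blockProj n i) = Qm i := fun i => by
    rw [hG, hQd' i, ofReal_prod_blockProj hqd0]
    exact map_blockProj_withDensity_prod (F := fun i x => ENNReal.ofReal (qd i x))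
      (fun i => (hqdm i).ennreal_ofReal) (fun i => (hQcop' i).marg _) i
  have hmoment : ∀ (P : Measure (FullIdx Q n → ℝ)) i j,
      ∫ v, η i v j ∂(P.map (blockProj n i)) = ∫ u, η i (blockProj n i u) j ∂P := fun P i j =>
    integral_map (hm i).aemeasurable (hηm i j).aestronglyMeasurable
  have hGcons : ∀ i j, ∫ u, η i (blockProj n i u) j ∂G = β i j := fun i j => by
    rw [← hmoment, hGmap, hQcons]
  have hgm : Measurable fun u : FullIdx Q n → ℝ => ∏ i, qd i (blockProj n i u) :=
    Finset.measurable_prod _ fun i _ => (hqdm i).comp (hm i)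
  have hg0 : ∀ u : FullIdx Q n → ℝ, 0 ≤ ∏ i, qd i (blockProj n i u) :=
    fun u => Finset.prod_nonneg fun i _ => hqd0 i _
  obtain ⟨hint, hsum⟩ := integral_log_prod_blockProj (P := G) hqdm hqd0
    (fun i => (hGmap i).trans (hQd' i)) fun i => (hGmap i).symm ▸ hQfin i
  have hGfin : FiniteEnt G := by
    rw [hG] at hint ⊢
    exact (finiteEnt_withDensity_iff_integrable_log hgm hg0).2 hint
  have hGent : diffEnt G = ∑ i, diffEnt (Qm i) := by
    have h := diffEnt_withDensity_eq_log hgm hg0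
    rw [← hG, hsum, neg_neg] at h
    simpa only [hGmap] using h
  have hGmax : ∀ P : Measure (FullIdx Q n → ℝ), IsCopulaI P →
      (∀ i j, ∫ u, η i (blockProj n i u) j ∂P = β i j) → FiniteEnt P →
      diffEnt P ≤ diffEnt G := fun P hP hPc hPfin => by
    rw [hGent]
    exact (hP.diffEnt_le_sum hPfin).trans (Finset.sum_le_sum fun i _ =>
      hQmax i _ (hP.map_blockProj i) (fun j => (hmoment P i j).trans (hPc i j))
        (hP.finiteEnt_map_blockProj hPfin i))
  have hηint : ∀ P : Measure (FullIdx Q n → ℝ), IsCopulaI P →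
      ∀ i j, Integrable (fun u => η i (blockProj n i u) j) P := fun P hP i j => by
    obtain ⟨C, hC⟩ := hηb i
    have h : Integrable (fun v => η i v j) (P.map (blockProj n i)) :=
      (hP.map_blockProj i).integrable_of_bounded (hηm i j) fun v hv => hC v hv j
    exact h.comp_measurable (hm i)
  refine ⟨hGcop, hGcons, ⟨hGfin, hGmax, fun P hP hPc hPfin hPmax => ?_⟩, hGent⟩
  refine hP.eq_of_maximal hGcop hPfin hGfin (κ := (i : Fin Q) × Fin (r i))
    (f := fun k u => η k.1 (blockProj n k.1 u) k.2) (b := fun k => β k.1 k.2)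
    (fun P hP k => hηint P hP k.1 k.2) (fun k => hPc k.1 k.2) (fun k => hGcons k.1 k.2)
    (fun P' hP' hc => hPmax P' hP' fun i j => hc ⟨i, j⟩)
    (fun P' hP' hc => hGmax P' hP' fun i j => hc ⟨i, j⟩)
end
end

section
/- Let φ : [0,1]^d → ℝ^q be a bounded measurable function whose coordinate functions are linearly independent in the sense that no nontrivial linear combination of them vanishes Lebesgue-almost everywhere on [0,1]^d, and let α ∈ ℝ^q. Then the function F(θ) := −θᵀα + ∫_{[0,1]^d} e^{θᵀφ(u)} du is strictly convex on ℝ^q. -/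
open MeasureTheory Real Set Filter

noncomputable section
open scoped Classical

/-- The unit cube `[0,1]^d`. -/
def Cube (d : ℕ) : Set (Fin d → ℝ) := Set.univ.pi fun _ => Set.Icc (0:ℝ) 1

/-- A copula distribution on `[0,1]^d`: a probability measure supported on the cube,
absolutely continuous w.r.t. Lebesgue measure, with uniform one-dimensional marginals. -/
structure IsCopula {d : ℕ} (P : Measure (Fin d → ℝ)) : Prop where
  prob : IsProbabilityMeasure P
  ac : P ≪ volume
  mass : P (Cube d) = 1
  marg : ∀ i : Fin d, P.map (fun u => u i) = unif01

theorem measurableSet_cube (d : ℕ) : MeasurableSet (Cube d) :=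
  MeasurableSet.univ_pi fun _ => measurableSet_Icc

instance isFiniteMeasure_restrict_cube (d : ℕ) :
    IsFiniteMeasure ((volume : Measure (Fin d → ℝ)).restrict (Cube d)) :=
  isFiniteMeasure_restrict.2 (isCompact_univ_pi fun _ => isCompact_Icc).measure_ne_top

/-- The exponential of a linear combination of bounded measurable functions is integrable
for a finite measure. -/
theorem integrable_exp_sum_mul {Ω ι : Type*} [MeasurableSpace Ω] [Fintype ι] {μ : Measure Ω}
    [IsFiniteMeasure μ] {φ : Ω → ι → ℝ} (hφm : Measurable φ) {C : ℝ}
    (hφb : ∀ᵐ u ∂μ, ∀ j, |φ u j| ≤ C) (θ : ι → ℝ) :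
    Integrable (fun u => Real.exp (∑ j, θ j * φ u j)) μ := by
  refine Integrable.of_bound (C := Real.exp (∑ j, |θ j| * C))
    (by fun_prop) ?_
  filter_upwards [hφb] with u hu
  rw [Real.norm_eq_abs, Real.abs_exp, Real.exp_le_exp]
  refine Finset.sum_le_sum fun j _ => (le_abs_self _).trans ?_
  rw [abs_mul]
  exact mul_le_mul_of_nonneg_left (hu j) (abs_nonneg _)

/-- Strict convexity of `f ↦ ∫ exp f` along two functions that are not almost everywhere equal. -/
theorem integral_exp_convex_combination_lt {Ω : Type*} [MeasurableSpace Ω] {μ : Measure Ω}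
    {f g : Ω → ℝ} {a b : ℝ} (ha : 0 < a) (hb : 0 < b) (hab : a + b = 1)
    (hf : Integrable (fun u => Real.exp (f u)) μ) (hg : Integrable (fun u => Real.exp (g u)) μ)
    (hfg : Integrable (fun u => Real.exp (a * f u + b * g u)) μ) (hne : ¬ f =ᵐ[μ] g) :
    ∫ u, Real.exp (a * f u + b * g u) ∂μ <
      a * ∫ u, Real.exp (f u) ∂μ + b * ∫ u, Real.exp (g u) ∂μ := by
  have hi : Integrable (fun u => a * Real.exp (f u) + b * Real.exp (g u)) μ :=
    (hf.const_mul a).add (hg.const_mul b)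
  have hle : ∀ u, Real.exp (a * f u + b * g u) ≤ a * Real.exp (f u) + b * Real.exp (g u) :=
    fun u => convexOn_exp.2 (mem_univ (f u)) (mem_univ (g u)) ha.le hb.le hab
  rw [← integral_const_mul, ← integral_const_mul,
    ← integral_add (hf.const_mul a) (hg.const_mul b)]
  refine (integral_mono hfg hi hle).lt_of_ne fun heq => hne ?_
  filter_upwards [(integral_eq_iff_of_ae_le hfg hi (ae_of_all _ hle)).1 heq] with u hu
  by_contra h
  exact (strictConvexOn_exp.2 (mem_univ (f u)) (mem_univ (g u)) h ha hb hab).ne hu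

/-- The (CVX-MIND) objective `θ ↦ -θᵀα + ∫_{[0,1]^d} e^{θᵀφ(u)} du` is strictly convex. -/
theorem cvx_mind_strictly_convex {d q : ℕ}
    (φ : (Fin d → ℝ) → Fin q → ℝ) (hφm : Measurable φ)
    (hφb : ∃ C, ∀ u ∈ Cube d, ∀ j, |φ u j| ≤ C)
    (hφli : ∀ θ : Fin q → ℝ,
      (∀ᵐ u ∂volume.restrict (Cube d), ∑ j, θ j * φ u j = 0) → θ = 0)
    (α : Fin q → ℝ) :
    StrictConvexOn ℝ Set.univ
      (fun θ : Fin q → ℝ =>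
        -(∑ j, θ j * α j) + ∫ u in Cube d, Real.exp (∑ j, θ j * φ u j)) := by
  obtain ⟨C, hC⟩ := hφb
  have hint := integrable_exp_sum_mul (μ := volume.restrict (Cube d)) hφm
    (ae_restrict_of_forall_mem (measurableSet_cube d) hC)
  refine ⟨convex_univ, fun x _ y _ hxy a b ha hb hab => ?_⟩
  have hcomb : ∀ v : Fin q → ℝ,
      ∑ j, (a • x + b • y) j * v j = a * ∑ j, x j * v j + b * ∑ j, y j * v j := fun v => by
    simp only [Pi.add_apply, Pi.smul_apply, smul_eq_mul, add_mul, Finset.sum_add_distrib,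
      Finset.mul_sum, mul_assoc]
  have hlt := integral_exp_convex_combination_lt ha hb hab (hint x) (hint y)
    (by simpa only [hcomb] using hint (a • x + b • y)) fun h =>
      hxy <| sub_eq_zero.1 <| hφli (x - y) <| h.mono fun u hu => by
        simpa only [Pi.sub_apply, sub_mul, Finset.sum_sub_distrib, sub_eq_zero] using hu
  simp only [hcomb, smul_eq_mul]
  linarith
end
end

section
/- Let φ : [0,1]^d → ℝ^q be a bounded continuous function whose first coordinate is the constant function 1 and whose coordinate functions are linearly independent (no nontrivial linear combination vanishes Lebesgue-almost everywhere), and let α ∈ ℝ^q have first coordinate 1. If θ* ∈ ℝ^q minimizes F(θ) := −θᵀα + ∫_{[0,1]^d} e^{θᵀφ(u)} du over ℝ^q, then ∫_{[0,1]^d} e^{θ*ᵀφ(u)} du = 1, the measure on [0,1]^d with Lebesgue density u ↦ e^{θ*ᵀφ(u)} is a probability measure satisfying E[φ] = α, and it is the unique maximizer of differential entropy over all absolutely continuous probability measures on [0,1]^d satisfying E[φ] = α. -/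
open MeasureTheory Real Set Filter

noncomputable section
open scoped Classical

/-- The set of absolutely continuous probability measures on the cube satisfying the linear
constraint `E_P[φ] = α`. -/
def InD {d q : ℕ} (φ : (Fin d → ℝ) → Fin q → ℝ) (α : Fin q → ℝ)
    (P : Measure (Fin d → ℝ)) : Prop :=
  IsProbabilityMeasure P ∧ P ≪ volume ∧ P (Cube d) = 1 ∧ ∀ j, ∫ u, φ u j ∂P = α j

/-- The measure supported on `s` whose density with respect to the reference measure is
`exp ∘ f`. -/
def expMeasure {E : Type*} [MeasureSpace E] (s : Set E) (f : E → ℝ) : Measure E :=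
  (volume.restrict s).withDensity (fun u => ENNReal.ofReal (Real.exp (f u)))

/-- The Gibbs pointwise inequality behind nonnegativity of relative entropy. -/
lemma mul_log_sub_mul_sub_add_exp_nonneg {p : ℝ} (hp : 0 ≤ p) (y : ℝ) :
    0 ≤ p * Real.log p - p * y - p + Real.exp y ∧
      (p * Real.log p - p * y - p + Real.exp y = 0 → p = Real.exp y) := by
  have hy := Real.exp_pos y
  have hq : 0 ≤ p / Real.exp y := by positivity
  have key : p * Real.log p - p * y - p + Real.exp y =
      Real.exp y * InformationTheory.klFun (p / Real.exp y) := by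
    rw [InformationTheory.klFun_apply]
    rcases hp.eq_or_lt with rfl | hp'
    · simp
    · rw [Real.log_div hp'.ne' hy.ne', Real.log_exp]
      field_simp
      ring
  rw [key]
  refine ⟨mul_nonneg hy.le (InformationTheory.klFun_nonneg hq), fun h => ?_⟩
  rw [mul_eq_zero, or_iff_right hy.ne', InformationTheory.klFun_eq_zero_iff hq,
    div_eq_one_iff_eq hy.ne'] at h
  exact h

section ExpMeasure

variable {E : Type*} [MeasureSpace E] {s : Set E} {f : E → ℝ}

lemma expMeasure_absolutelyContinuous : expMeasure s f ≪ volume :=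
  (withDensity_absolutelyContinuous _ _).trans Measure.absolutelyContinuous_restrict

lemma expMeasure_compl (hs : MeasurableSet s) : expMeasure s f sᶜ = 0 :=
  withDensity_absolutelyContinuous _ _ (by simp [Measure.restrict_apply hs.compl])

variable [SigmaFinite (volume : Measure E)]

lemma rnDeriv_expMeasure (hs : MeasurableSet s) (hf : Measurable f) :
    (expMeasure s f).rnDeriv volume =ᵐ[volume]
      s.indicator (fun u => ENNReal.ofReal (Real.exp (f u))) := by
  rw [expMeasure, ← withDensity_indicator hs]
  exact Measure.rnDeriv_withDensity _
    (hf.exp.ennreal_ofReal.indicator hs)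

lemma dens_expMeasure (hs : MeasurableSet s) (hf : Measurable f) :
    dens (expMeasure s f) =ᵐ[volume] s.indicator (fun u => Real.exp (f u)) := by
  filter_upwards [rnDeriv_expMeasure hs hf] with x hx
  by_cases h : x ∈ s <;> simp [dens, hx, h, (Real.exp_pos _).le]

lemma dens_expMeasure_mul_log (hs : MeasurableSet s) (hf : Measurable f) :
    (fun x => dens (expMeasure s f) x * Real.log (dens (expMeasure s f) x)) =ᵐ[volume]
      fun x => ((expMeasure s f).rnDeriv volume x).toReal • f x := by
  filter_upwards [dens_expMeasure hs hf] with x hx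
  change _ = dens (expMeasure s f) x • f x
  by_cases h : x ∈ s <;> simp [hx, h]

lemma finiteEnt_expMeasure [SigmaFinite (expMeasure s f)] (hs : MeasurableSet s)
    (hf : Measurable f) (hint : Integrable f (expMeasure s f)) :
    FiniteEnt (expMeasure s f) :=
  (integrable_congr (dens_expMeasure_mul_log hs hf)).2
    ((integrable_rnDeriv_smul_iff expMeasure_absolutelyContinuous).2 hint)

lemma diffEnt_expMeasure [SigmaFinite (expMeasure s f)] (hs : MeasurableSet s)
    (hf : Measurable f) :
    diffEnt (expMeasure s f) = -∫ x, f x ∂expMeasure s f := by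
  rw [diffEnt, integral_congr_ae (dens_expMeasure_mul_log hs hf),
    integral_rnDeriv_smul expMeasure_absolutelyContinuous]

lemma rnDeriv_eq_zero_of_compl {P : Measure E} [SigmaFinite P] (hP : P ≪ volume)
    (hs : MeasurableSet s) (hPs : P sᶜ = 0) :
    ∀ᵐ x, x ∉ s → P.rnDeriv volume x = 0 := by
  rw [← Measure.setLIntegral_rnDeriv hP,
    lintegral_eq_zero_iff (Measure.measurable_rnDeriv _ _)] at hPs
  exact (ae_restrict_iff' hs.compl).1 hPs

/-- Gibbs' inequality: cross entropy against a density `exp ∘ f` bounds differential entropy,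
with equality only for that density. -/
lemma diffEnt_le_and_eq_expMeasure [IsProbabilityMeasure (expMeasure s f)]
    (hs : MeasurableSet s) (hf : Measurable f) {P : Measure E} [IsProbabilityMeasure P]
    (hP : P ≪ volume) (hPs : P sᶜ = 0) (hint : Integrable f P) (hent : FiniteEnt P) :
    diffEnt P ≤ -∫ x, f x ∂P ∧ (diffEnt P = -∫ x, f x ∂P → P = expMeasure s f) := by
  set D : E → ℝ := fun x => dens P x * Real.log (dens P x)
    - (P.rnDeriv volume x).toReal • f x - (P.rnDeriv volume x).toReal
    + ((expMeasure s f).rnDeriv volume x).toReal with hD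
  have hif : Integrable (fun x => (P.rnDeriv volume x).toReal • f x) :=
    (integrable_rnDeriv_smul_iff hP).2 hint
  have hsub : Integrable (fun x => dens P x * Real.log (dens P x)
      - (P.rnDeriv volume x).toReal • f x) := hent.sub hif
  have hsub' : Integrable (fun x => dens P x * Real.log (dens P x)
      - (P.rnDeriv volume x).toReal • f x - (P.rnDeriv volume x).toReal) :=
    hsub.sub Measure.integrable_toReal_rnDeriv
  have hD_int : Integrable D := hsub'.add Measure.integrable_toReal_rnDeriv
  have hD_integral : ∫ x, D x = -diffEnt P - ∫ x, f x ∂P := by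
    rw [hD, integral_add hsub' Measure.integrable_toReal_rnDeriv,
      integral_sub hsub Measure.integrable_toReal_rnDeriv,
      integral_sub hent hif, integral_rnDeriv_smul hP, Measure.integral_toReal_rnDeriv hP,
      Measure.integral_toReal_rnDeriv expMeasure_absolutelyContinuous, diffEnt]
    simp
  have hpt : ∀ᵐ x, 0 ≤ D x ∧
      (D x = 0 → P.rnDeriv volume x = (expMeasure s f).rnDeriv volume x) := by
    filter_upwards [rnDeriv_eq_zero_of_compl hP hs hPs, rnDeriv_expMeasure hs hf,
      P.rnDeriv_lt_top volume] with x h0 hx htop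
    by_cases h : x ∈ s
    · have hx' : ((expMeasure s f).rnDeriv volume x).toReal = Real.exp (f x) := by
        simp [hx, h, (Real.exp_pos _).le]
      have := mul_log_sub_mul_sub_add_exp_nonneg
        (ENNReal.toReal_nonneg (a := P.rnDeriv volume x)) (f x)
      simp only [hD, hx', dens, smul_eq_mul]
      refine ⟨this.1, fun h' => ?_⟩
      rw [hx, Set.indicator_of_mem h, ← this.2 h', ENNReal.ofReal_toReal htop.ne]
    · simp [hD, dens, hx, h, h0 h]
  have hD_nonneg : 0 ≤ᵐ[volume] D := hpt.mono fun _ h => h.1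
  refine ⟨by linarith [integral_nonneg_of_ae hD_nonneg], fun heq => ?_⟩
  have hD0 : D =ᵐ[volume] 0 :=
    (integral_eq_zero_iff_of_nonneg_ae hD_nonneg hD_int).1 (by linarith)
  rw [← Measure.withDensity_rnDeriv_eq P volume hP,
    ← Measure.withDensity_rnDeriv_eq (expMeasure s f) volume expMeasure_absolutelyContinuous]
  refine withDensity_congr_ae ?_
  filter_upwards [hpt, hD0] with x hx hx0 using hx.2 hx0

end ExpMeasure

/-- If `t ↦ mgf X μ t - t * a` is minimal at `0` for a bounded `X`, then `X` has mean `a`. -/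
lemma integral_eq_of_mgf_sub_mul_min {Ω : Type*} [MeasurableSpace Ω] {μ : Measure Ω}
    [IsFiniteMeasure μ] {X : Ω → ℝ} {a C : ℝ} (hX : AEMeasurable X μ)
    (hb : ∀ᵐ x ∂μ, |X x| ≤ C)
    (hmin : ∀ t, ProbabilityTheory.mgf X μ 0 ≤ ProbabilityTheory.mgf X μ t - t * a) :
    ∫ x, X x ∂μ = a := by
  have huniv : ProbabilityTheory.integrableExpSet X μ = Set.univ :=
    Set.eq_univ_of_forall fun t => ProbabilityTheory.integrable_exp_mul_of_mem_Icc hX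
      (hb.mono fun x hx => abs_le.1 hx)
  have hd := (ProbabilityTheory.hasDerivAt_mgf (X := X) (μ := μ) (t := 0)
    (by simp [huniv])).sub ((hasDerivAt_id (0 : ℝ)).mul_const a)
  have hloc : IsLocalMin (ProbabilityTheory.mgf X μ - fun t => id t * a) 0 :=
    Filter.Eventually.of_forall fun t => by simpa using hmin t
  have := hloc.hasDerivAt_eq_zero hd
  simp only [zero_mul, Real.exp_zero, mul_one, one_mul] at this
  linarith

lemma isCompact_cube (d : ℕ) : IsCompact (Cube d) :=
  isCompact_univ_pi fun _ => isCompact_Icc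

/-- A minimizer of the (CVX-MIND) objective yields a normalized exponential-family density
which is the unique maximum-entropy distribution under the constraints. -/
theorem cvx_mind_minimizer {d q : ℕ} [NeZero q]
    (φ : (Fin d → ℝ) → Fin q → ℝ) (hφc : Continuous φ)
    (hφb : ∃ C, ∀ u ∈ Cube d, ∀ j, |φ u j| ≤ C)
    (hφ1 : ∀ u, φ u 0 = 1)
    (hφli : ∀ θ : Fin q → ℝ,
      (∀ᵐ u ∂volume.restrict (Cube d), ∑ j, θ j * φ u j = 0) → θ = 0)
    (α : Fin q → ℝ) (hα : α 0 = 1)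
    (θs : Fin q → ℝ)
    (hmin : ∀ θ : Fin q → ℝ,
      -(∑ j, θs j * α j) + ∫ u in Cube d, Real.exp (∑ j, θs j * φ u j)
        ≤ -(∑ j, θ j * α j) + ∫ u in Cube d, Real.exp (∑ j, θ j * φ u j)) :
    (∫ u in Cube d, Real.exp (∑ j, θs j * φ u j)) = 1 ∧
    InD φ α ((volume.restrict (Cube d)).withDensity
      (fun u => ENNReal.ofReal (Real.exp (∑ j, θs j * φ u j)))) ∧
    FiniteEnt ((volume.restrict (Cube d)).withDensity
      (fun u => ENNReal.ofReal (Real.exp (∑ j, θs j * φ u j)))) ∧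
    (∀ P, InD φ α P → FiniteEnt P →
      diffEnt P ≤ diffEnt ((volume.restrict (Cube d)).withDensity
        (fun u => ENNReal.ofReal (Real.exp (∑ j, θs j * φ u j))))) ∧
    (∀ P, InD φ α P → FiniteEnt P →
      (∀ P', InD φ α P' → FiniteEnt P' → diffEnt P' ≤ diffEnt P) →
      P = (volume.restrict (Cube d)).withDensity
        (fun u => ENNReal.ofReal (Real.exp (∑ j, θs j * φ u j)))) := by
  obtain ⟨C, hC⟩ := hφb
  have hs : MeasurableSet (Cube d) := (isCompact_cube d).measurableSet
  set f : (Fin d → ℝ) → ℝ := fun u => ∑ j, θs j * φ u j with hf_def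
  have hφj : ∀ j, Continuous fun u => φ u j := fun j => (continuous_apply j).comp hφc
  have hfc : Continuous f := continuous_finsetSum _ fun j _ => (hφj j).const_mul (θs j)
  have hf : Measurable f := hfc.measurable
  have hexp_int : IntegrableOn (fun u => Real.exp (f u)) (Cube d) :=
    (Real.continuous_exp.comp hfc).continuousOn.integrableOn_compact (isCompact_cube d)
  change _ ∧ InD φ α (expMeasure (Cube d) f) ∧ FiniteEnt (expMeasure (Cube d) f) ∧
    (∀ P, InD φ α P → FiniteEnt P → diffEnt P ≤ diffEnt (expMeasure (Cube d) f)) ∧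
    (∀ P, InD φ α P → FiniteEnt P →
      (∀ P', InD φ α P' → FiniteEnt P' → diffEnt P' ≤ diffEnt P) →
      P = expMeasure (Cube d) f)
  have hfin : IsFiniteMeasure (expMeasure (Cube d) f) :=
    isFiniteMeasure_withDensity_ofReal hexp_int.2
  have integral_expMeasure : ∀ g : (Fin d → ℝ) → ℝ,
      ∫ u, g u ∂expMeasure (Cube d) f = ∫ u in Cube d, Real.exp (f u) * g u := fun g => by
    rw [expMeasure, integral_withDensity_eq_integral_toReal_smul
      hf.exp.ennreal_ofReal (by simp)]
    simp [(Real.exp_pos _).le]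
  have hbound : ∀ P : Measure (Fin d → ℝ), P (Cube d)ᶜ = 0 → ∀ j, ∀ᵐ u ∂P, |φ u j| ≤ C :=
    fun P hP j => by
      have : ∀ᵐ u ∂P, u ∈ Cube d := hP
      exact this.mono fun u hu => hC u hu j
  have hmean : ∀ j, ∫ u, φ u j ∂expMeasure (Cube d) f = α j := by
    intro j
    refine integral_eq_of_mgf_sub_mul_min (hφj j).aemeasurable
      (hbound _ (expMeasure_compl hs) j) fun t => ?_
    have h := hmin (θs + Pi.single j t)
    simp only [Pi.add_apply, add_mul, Finset.sum_add_distrib, Pi.single_apply, ite_mul,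
      zero_mul, Finset.sum_ite_eq', Finset.mem_univ, if_true, Real.exp_add] at h
    simp only [ProbabilityTheory.mgf, integral_expMeasure, zero_mul, Real.exp_zero, mul_one]
    linarith
  have hone : ∫ u in Cube d, Real.exp (f u) = 1 := by
    have h := hmean 0
    simpa only [hφ1, hα, integral_expMeasure, mul_one] using h
  have hprob : IsProbabilityMeasure (expMeasure (Cube d) f) := by
    refine ⟨?_⟩
    have h := hmean 0
    simp only [hφ1, hα, integral_const, smul_eq_mul, mul_one, Measure.real] at h
    exact (ENNReal.toReal_eq_one_iff _).1 h
  have hcompl : ∀ {P : Measure (Fin d → ℝ)}, InD φ α P → P (Cube d)ᶜ = 0 := fun hP => by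
    have := hP.1
    exact (prob_compl_eq_zero_iff hs).2 hP.2.2.1
  have hφint : ∀ {P : Measure (Fin d → ℝ)}, InD φ α P → ∀ j, Integrable (fun u => φ u j) P :=
    fun {P} hP j => by
      have := hP.1
      exact Integrable.of_bound (hφj j).aestronglyMeasurable C (hbound P (hcompl hP) j)
  have hfint : ∀ {P : Measure (Fin d → ℝ)}, InD φ α P → Integrable f P := fun hP =>
    integrable_finsetSum _ fun j _ => (hφint hP j).const_mul (θs j)
  have hf_integral : ∀ {P : Measure (Fin d → ℝ)}, InD φ α P →
      ∫ u, f u ∂P = ∑ j, θs j * α j := fun hP => by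
    rw [hf_def, integral_finsetSum _ fun j _ => (hφint hP j).const_mul (θs j)]
    simp only [integral_const_mul, hP.2.2.2]
  have hInD : InD φ α (expMeasure (Cube d) f) :=
    ⟨hprob, expMeasure_absolutelyContinuous,
      (prob_compl_eq_zero_iff hs).1 (expMeasure_compl hs), hmean⟩
  have hent := finiteEnt_expMeasure hs hf (hfint hInD)
  have hmax : diffEnt (expMeasure (Cube d) f) = -∑ j, θs j * α j := by
    rw [diffEnt_expMeasure hs hf, hf_integral hInD]
  have hgibbs : ∀ P, InD φ α P → FiniteEnt P →
      diffEnt P ≤ diffEnt (expMeasure (Cube d) f) ∧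
        (diffEnt P = diffEnt (expMeasure (Cube d) f) → P = expMeasure (Cube d) f) := by
    intro P hP hPent
    have := hP.1
    rw [hmax, ← hf_integral hP]
    exact diffEnt_le_and_eq_expMeasure hs hf hP.2.1 (hcompl hP) (hfint hP) hPent
  exact ⟨hone, hInD, hent, fun P hP hPent => (hgibbs P hP hPent).1,
    fun P hP hPent hPmax => (hgibbs P hP hPent).2
      (le_antisymm (hgibbs P hP hPent).1 (hPmax _ hInD hent))⟩
end
end
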